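/- arXiv:2005.06238 — 9 statements merged into one kernel-verified Lean document; each statement's English description precedes it below -/
import Mathlib

section
/- There exists a constant C ∈ ℝ such that the function f : Sym₀ → ℝ defined by f(Q) = C − (a/2)·tr(Q²) − (b/3)·tr(Q³) + (c/4)·(tr(Q²))² satisfies: f(Q) ≥ 0 for every Q ∈ Sym₀, the minimum of f over Sym₀ equals 0, and f(Q) = 0 if and only if Q = s*(n⊗n − (1/3)Id) for some unit vector n ∈ S², where s* = (b + √(b² + 24ac))/(4c). -/
open Matrix

noncomputable section

/-- The space `Sym₀` of symmetric traceless `3 × 3` real matrices (as a subset of matrices). -/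
def Sym0 : Set (Matrix (Fin 3) (Fin 3) ℝ) := {Q | Q.IsSymm ∧ Q.trace = 0}

/-- The norm `|Q| = √(tr Q²)`. -/
def nrm (Q : Matrix (Fin 3) (Fin 3) ℝ) : ℝ := Real.sqrt ((Q * Q).trace)

/-- The Landau-de Gennes bulk potential
`f(Q) = C - a/2 tr(Q²) - b/3 tr(Q³) + c/4 (tr(Q²))²`. -/
def fLdG (a b c C : ℝ) (Q : Matrix (Fin 3) (Fin 3) ℝ) : ℝ :=
  C - a / 2 * (Q * Q).trace - b / 3 * (Q * Q * Q).trace + c / 4 * ((Q * Q).trace) ^ 2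

/-- `s* = (b + √(b² + 24 a c))/(4c)`. -/
def sstar (a b c : ℝ) : ℝ := (b + Real.sqrt (b ^ 2 + 24 * a * c)) / (4 * c)

/-- The matrix `n ⊗ n` with entries `nᵢ nⱼ`. -/
def outer (n : Fin 3 → ℝ) : Matrix (Fin 3) (Fin 3) ℝ := Matrix.of fun i j => n i * n j

/-- `n` is a unit vector of `ℝ³`. -/
def unitVec (n : Fin 3 → ℝ) : Prop := n 0 ^ 2 + n 1 ^ 2 + n 2 ^ 2 = 1

/-- The uniaxial matrix `s (n ⊗ n - Id/3)`. -/
def uniax (s : ℝ) (n : Fin 3 → ℝ) : Matrix (Fin 3) (Fin 3) ℝ :=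
  s • (outer n - (1 / 3 : ℝ) • (1 : Matrix (Fin 3) (Fin 3) ℝ))

theorem exists_rank_one_of_pos {x y z p q w : ℝ} (hx : 0 < x)
    (hxy : x * y = p ^ 2) (hxz : x * z = q ^ 2) (hxw : x * w = p * q) :
    ∃ u v t : ℝ, u ^ 2 = x ∧ v ^ 2 = y ∧ t ^ 2 = z ∧ u * v = p ∧ u * t = q ∧ v * t = w := by
  have hs : Real.sqrt x ^ 2 = x := Real.sq_sqrt hx.le
  have hp : Real.sqrt x ≠ 0 := (Real.sqrt_pos.2 hx).ne'
  refine ⟨Real.sqrt x, p / Real.sqrt x, q / Real.sqrt x, hs, ?_, ?_, ?_, ?_, ?_⟩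
  · rw [div_pow, hs, ← hxy]; field_simp
  · rw [div_pow, hs, ← hxz]; field_simp
  · field_simp
  · field_simp
  · rw [div_mul_div_comm, ← sq, hs, ← hxw]; field_simp

/-- A symmetric `3 × 3` array with vanishing `2 × 2` minors and trace one has rank one. -/
theorem exists_rank_one {x y z p q w : ℝ} (htr : x + y + z = 1)
    (hxy : x * y = p ^ 2) (hxz : x * z = q ^ 2) (hyz : y * z = w ^ 2)
    (hxw : x * w = p * q) (hyq : y * q = p * w) (hzp : z * p = q * w) :
    ∃ u v t : ℝ, u ^ 2 = x ∧ v ^ 2 = y ∧ t ^ 2 = z ∧ u * v = p ∧ u * t = q ∧ v * t = w := by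
  by_cases hx : 0 < x
  · exact exists_rank_one_of_pos hx hxy hxz hxw
  by_cases hy : 0 < y
  · obtain ⟨v, u, t, h1, h2, h3, h4, h5, h6⟩ :=
      exists_rank_one_of_pos hy (by rw [mul_comm]; exact hxy) hyz hyq
    exact ⟨u, v, t, h2, h1, h3, by rw [mul_comm]; exact h4, h6, h5⟩
  · obtain ⟨t, u, v, h1, h2, h3, h4, h5, h6⟩ :=
      exists_rank_one_of_pos (x := z) (by linarith) (by rw [mul_comm]; exact hxz)
        (by rw [mul_comm]; exact hyz) hzp
    exact ⟨u, v, t, h2, h3, h1, h6, by rw [mul_comm]; exact h4, by rw [mul_comm]; exact h5⟩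

theorem sstar_pos {a b c : ℝ} (hb : 0 < b) (hc : 0 < c) : 0 < sstar a b c := by
  unfold sstar
  have := Real.sqrt_nonneg (b ^ 2 + 24 * a * c)
  positivity

theorem sstar_quadratic {a b c : ℝ} (ha : 0 < a) (hc : 0 < c) :
    2 * c * sstar a b c ^ 2 - b * sstar a b c - 3 * a = 0 := by
  have h : Real.sqrt (b ^ 2 + 24 * a * c) ^ 2 = b ^ 2 + 24 * a * c :=
    Real.sq_sqrt (by positivity)
  unfold sstar
  generalize Real.sqrt (b ^ 2 + 24 * a * c) = t at h ⊢
  field_simp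
  linear_combination 2 * h

/-- The entries of a symmetric traceless matrix. -/
theorem eq_of_mem_Sym0 {Q : Matrix (Fin 3) (Fin 3) ℝ} (hQ : Q ∈ Sym0) :
    ∃ x y p q w : ℝ, Q = !![x, p, q; p, y, w; q, w, -x - y] := by
  obtain ⟨hs, ht⟩ := hQ
  refine ⟨Q 0 0, Q 1 1, Q 0 1, Q 0 2, Q 1 2, ?_⟩
  have h10 := hs.apply 0 1
  have h20 := hs.apply 0 2
  have h21 := hs.apply 1 2
  rw [Matrix.trace_fin_three] at ht
  ext i j
  fin_cases i <;> fin_cases j <;> simp [h10, h20, h21]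
  linarith

/-- The matrix whose vanishing characterises `uniax r n` among traceless symmetric matrices. -/
def uniaxDefect (r : ℝ) (Q : Matrix (Fin 3) (Fin 3) ℝ) : Matrix (Fin 3) (Fin 3) ℝ :=
  Q * Q - (r / 3) • Q - (2 * r ^ 2 / 9) • (1 : Matrix (Fin 3) (Fin 3) ℝ)

theorem sum_sq_uniaxDefect {Q : Matrix (Fin 3) (Fin 3) ℝ} (hQ : Q ∈ Sym0) (r : ℝ) :
    ∑ i, ∑ j, uniaxDefect r Q i j ^ 2 =
      (Q * Q).trace ^ 2 / 2 - 2 * r / 3 * (Q * Q * Q).trace - r ^ 2 / 3 * (Q * Q).trace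
        + 4 * r ^ 4 / 27 := by
  obtain ⟨x, y, p, q, w, rfl⟩ := eq_of_mem_Sym0 hQ
  simp [uniaxDefect, Fin.sum_univ_three, Matrix.trace_fin_three,
    Matrix.one_apply]
  ring

theorem exists_uniax_of_uniaxDefect_eq_zero {Q : Matrix (Fin 3) (Fin 3) ℝ} (hQ : Q ∈ Sym0)
    {s : ℝ} (hs : 0 < s) (h : uniaxDefect s Q = 0) :
    ∃ n : Fin 3 → ℝ, unitVec n ∧ Q = uniax s n := by
  obtain ⟨x, y, p, q, w, rfl⟩ := eq_of_mem_Sym0 hQ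
  have e (i j : Fin 3) := congrFun (congrFun h i) j
  have e00 := e 0 0
  have e01 := e 0 1
  have e02 := e 0 2
  have e11 := e 1 1
  have e12 := e 1 2
  have e22 := e 2 2
  simp [uniaxDefect] at e00 e01 e02 e11 e12 e22
  obtain ⟨u, v, t, h1, h2, h3, h4, h5, h6⟩ :=
    exists_rank_one (x := x / s + 1 / 3) (y := y / s + 1 / 3) (z := (-x - y) / s + 1 / 3)
      (p := p / s) (q := q / s) (w := w / s) (by field_simp; ring)
      (by field_simp; linear_combination (9 / 2) * (e22 - e00 - e11))
      (by field_simp; linear_combination (9 / 2) * (e11 - e00 - e22))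
      (by field_simp; linear_combination (9 / 2) * (e00 - e11 - e22))
      (by field_simp; linear_combination (-3) * e12)
      (by field_simp; linear_combination (-3) * e02)
      (by field_simp; linear_combination (-3) * e01)
  refine ⟨![u, v, t], ?_, ?_⟩
  · simp only [unitVec, Matrix.cons_val]
    rw [h1, h2, h3]
    field_simp
    ring
  · ext i j
    fin_cases i <;> fin_cases j <;>
      simp [uniax, outer, ← sq, h1, h2, h3, h4, h5, h6,
        mul_comm v u, mul_comm t u, mul_comm t v] <;> field_simp

theorem uniax_mem_Sym0 (s : ℝ) {n : Fin 3 → ℝ} (hn : unitVec n) : uniax s n ∈ Sym0 := by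
  unfold unitVec at hn
  constructor
  · ext i j
    simp [uniax, outer, Matrix.one_apply, mul_comm (n i), eq_comm]
  · simp only [uniax, outer, Matrix.trace_fin_three, Matrix.smul_apply, Matrix.sub_apply,
      Matrix.of_apply, Matrix.one_apply_eq, smul_eq_mul]
    linear_combination s * hn

theorem trace_sq_uniax (s : ℝ) {n : Fin 3 → ℝ} (hn : unitVec n) :
    (uniax s n * uniax s n).trace = 2 * s ^ 2 / 3 := by
  unfold unitVec at hn
  simp [uniax, outer, Matrix.trace_fin_three, Matrix.mul_apply, Fin.sum_univ_three,
    Matrix.one_apply]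
  linear_combination s ^ 2 * (n 0 ^ 2 + n 1 ^ 2 + n 2 ^ 2 + 1 / 3) * hn

theorem trace_cube_uniax (s : ℝ) {n : Fin 3 → ℝ} (hn : unitVec n) :
    (uniax s n * uniax s n * uniax s n).trace = 2 * s ^ 3 / 9 := by
  unfold unitVec at hn
  simp [uniax, outer, Matrix.trace_fin_three, Matrix.mul_apply, Fin.sum_univ_three,
    Matrix.one_apply]
  linear_combination s ^ 3 * ((n 0 ^ 2 + n 1 ^ 2 + n 2 ^ 2) ^ 2 + 1 / 3) * hn

/-- With `tr Q² = 2r²/3`, the cubic invariant satisfies `tr Q³ ≤ 2r³/9`. -/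
theorem trace_cube_le {Q : Matrix (Fin 3) (Fin 3) ℝ} (hQ : Q ∈ Sym0) {r : ℝ} (hr : 0 ≤ r)
    (h : (Q * Q).trace = 2 * r ^ 2 / 3) : (Q * Q * Q).trace ≤ 2 * r ^ 3 / 9 := by
  rcases hr.eq_or_lt with rfl | hr
  · have h0 : Q = 0 := by
      obtain ⟨hs, -⟩ := hQ
      have : (Qᵀ * Q).trace = 0 := by rw [hs.eq, h]; simp
      exact Matrix.trace_conjTranspose_mul_self_eq_zero_iff.1 (by simpa using this)
    simp [h0]
  · have hX := sum_sq_uniaxDefect hQ r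
    have hn : 0 ≤ ∑ i, ∑ j, uniaxDefect r Q i j ^ 2 := by positivity
    rw [hX, h] at hn
    have : 0 ≤ 2 * r / 3 * (2 * r ^ 3 / 9 - (Q * Q * Q).trace) := by linarith
    have := nonneg_of_mul_nonneg_right this (by positivity)
    linarith

theorem uniaxDefect_eq_zero {Q : Matrix (Fin 3) (Fin 3) ℝ} (hQ : Q ∈ Sym0) {r : ℝ}
    (h2 : (Q * Q).trace = 2 * r ^ 2 / 3) (h3 : (Q * Q * Q).trace = 2 * r ^ 3 / 9) :
    uniaxDefect r Q = 0 := by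
  have hX : ∑ i, ∑ j, uniaxDefect r Q i j ^ 2 = 0 := by
    rw [sum_sq_uniaxDefect hQ r, h2, h3]; ring
  ext i j
  rw [Finset.sum_eq_zero_iff_of_nonneg fun _ _ => by positivity] at hX
  have hi := hX i (Finset.mem_univ _)
  rw [Finset.sum_eq_zero_iff_of_nonneg fun _ _ => by positivity] at hi
  simpa using hi j (Finset.mem_univ _)

theorem fLdG_decomposition {a b c s r : ℝ} (hs : 2 * c * s ^ 2 - b * s - 3 * a = 0)
    {Q : Matrix (Fin 3) (Fin 3) ℝ} (h : (Q * Q).trace = 2 * r ^ 2 / 3) :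
    fLdG a b c (c * s ^ 4 / 9 - b * s ^ 3 / 27) Q =
      (r - s) ^ 2 * (c * r ^ 2 / 9 + 2 * (3 * c * s - b) / 27 * r + s * (3 * c * s - b) / 27)
        + b / 3 * (2 * r ^ 3 / 9 - (Q * Q * Q).trace) := by
  rw [fLdG, h]
  linear_combination r ^ 2 / 9 * hs

/-- There is a constant `C` such that `f ≥ 0` on `Sym₀`, the minimum of `f` over `Sym₀` is `0`
(i.e. the value `0` is attained), and `f(Q) = 0` exactly for the uniaxial matrices
`Q = s* (n ⊗ n - Id/3)` with `n` a unit vector. -/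
theorem statement0 (a b c : ℝ) (ha : 0 < a) (hb : 0 < b) (hc : 0 < c) :
    ∃ C : ℝ,
      (∀ Q ∈ Sym0, 0 ≤ fLdG a b c C Q) ∧
      (∃ Q ∈ Sym0, fLdG a b c C Q = 0) ∧
      (∀ Q ∈ Sym0, (fLdG a b c C Q = 0 ↔
        ∃ n : Fin 3 → ℝ, unitVec n ∧ Q = uniax (sstar a b c) n)) := by
  set s := sstar a b c with hsdef
  have hs : 0 < s := sstar_pos hb hc
  have hq : 2 * c * s ^ 2 - b * s - 3 * a = 0 := sstar_quadratic ha hc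
  have hk : 0 < 3 * c * s - b := by
    have h1 : 0 < s * (2 * c * s - b) := by linarith
    have h2 : 0 < 2 * c * s - b := pos_of_mul_pos_right h1 hs.le
    have h3 : 0 < c * s := mul_pos hc hs
    linarith
  have hr (Q : Matrix (Fin 3) (Fin 3) ℝ) (hQ : Q ∈ Sym0) :
      ∃ r : ℝ, 0 ≤ r ∧ (Q * Q).trace = 2 * r ^ 2 / 3 := by
    refine ⟨Real.sqrt (3 / 2 * (Q * Q).trace), Real.sqrt_nonneg _, ?_⟩
    have h0 : 0 ≤ (Q * Q).trace := by
      have := (Matrix.posSemidef_conjTranspose_mul_self Q).trace_nonneg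
      rwa [Matrix.conjTranspose_eq_transpose_of_trivial, hQ.1.eq] at this
    rw [Real.sq_sqrt (by positivity)]
    ring
  have hzero (n : Fin 3 → ℝ) (hn : unitVec n) :
      fLdG a b c (c * s ^ 4 / 9 - b * s ^ 3 / 27) (uniax s n) = 0 := by
    rw [fLdG_decomposition hq (trace_sq_uniax s hn), trace_cube_uniax s hn]
    ring
  refine ⟨c * s ^ 4 / 9 - b * s ^ 3 / 27, fun Q hQ => ?_, ?_, fun Q hQ => ⟨fun hf => ?_, ?_⟩⟩
  · obtain ⟨r, hr0, h2⟩ := hr Q hQ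
    have h3 := sub_nonneg.2 (trace_cube_le hQ hr0 h2)
    rw [fLdG_decomposition hq h2]
    positivity
  · have hn : unitVec ![1, 0, 0] := by simp [unitVec]
    exact ⟨_, uniax_mem_Sym0 s hn, hzero _ hn⟩
  · obtain ⟨r, hr0, h2⟩ := hr Q hQ
    have h3 := sub_nonneg.2 (trace_cube_le hQ hr0 h2)
    rw [fLdG_decomposition hq h2] at hf
    have hg : 0 < c * r ^ 2 / 9 + 2 * (3 * c * s - b) / 27 * r + s * (3 * c * s - b) / 27 := by
      positivity
    obtain ⟨hf1, hf2⟩ := (add_eq_zero_iff_of_nonneg (by positivity) (by positivity)).1 hf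
    have hrs : r = s := by
      have := (mul_eq_zero.1 hf1).resolve_right hg.ne'
      exact sub_eq_zero.1 (pow_eq_zero_iff two_ne_zero |>.1 this)
    have hT := (mul_eq_zero.1 hf2).resolve_left (by positivity)
    subst hrs
    exact exists_uniax_of_uniaxDefect_eq_zero hQ hs
      (uniaxDefect_eq_zero hQ h2 (sub_eq_zero.1 hT).symm)
  · rintro ⟨n, hn, rfl⟩
    exact hzero n hn

end
end

section
/- For every Q ∈ Sym₀ with |Q| > √(2/3)·s*, one has f(Q) > f( √(2/3)·s*·Q/|Q| ), i.e. radially truncating Q to the ball of radius √(2/3)·s* strictly decreases the bulk potential f. -/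
open Matrix

noncomputable section

/-- The vacuum manifold `N = { s* (n ⊗ n - Id/3) : n ∈ S² }`. -/
def Nset (a b c : ℝ) : Set (Matrix (Fin 3) (Fin 3) ℝ) :=
  {Q | ∃ n : Fin 3 → ℝ, unitVec n ∧ Q = uniax (sstar a b c) n}

/-- The distance `dist(Q, N) = inf_{P ∈ N} |Q - P|` measured in the norm `|·| = √(tr(·²))`. -/
def distN (a b c : ℝ) (Q : Matrix (Fin 3) (Fin 3) ℝ) : ℝ :=
  sInf ((fun P => nrm (Q - P)) '' Nset a b c)

/-- Traces of powers of a real symmetric matrix are the power sums of its eigenvalues. -/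
lemma trace_pow_eq_sum_eigenvalues_pow {n : Type*} [Fintype n] [DecidableEq n]
    {A : Matrix n n ℝ} (hA : A.IsHermitian) (k : ℕ) :
    (A ^ k).trace = ∑ i, hA.eigenvalues i ^ k := by
  conv_lhs => rw [hA.spectral_theorem, ← map_pow, Unitary.conjStarAlgAut_apply,
    Matrix.trace_mul_cycle, Unitary.coe_star_mul_self, one_mul, Matrix.diagonal_pow,
    Matrix.trace_diagonal]
  simp

/-- The sharp bound `6 (tr Q³)² ≤ (tr Q²)³` on `Sym₀`. -/
lemma six_mul_sq_trace_cube_le {Q : Matrix (Fin 3) (Fin 3) ℝ} (hQ : Q ∈ Sym0) :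
    6 * (Q * Q * Q).trace ^ 2 ≤ (Q * Q).trace ^ 3 := by
  have hA : Q.IsHermitian := by
    rw [Matrix.IsHermitian, Matrix.conjTranspose_eq_transpose_of_trivial]
    exact hQ.1
  have h1 := trace_pow_eq_sum_eigenvalues_pow hA 1
  have h2 := trace_pow_eq_sum_eigenvalues_pow hA 2
  have h3 := trace_pow_eq_sum_eigenvalues_pow hA 3
  rw [pow_one, hQ.2] at h1
  rw [pow_two] at h2
  rw [pow_succ, pow_two] at h3
  rw [h2, h3]
  simp only [Fin.sum_univ_three, pow_one] at h1 ⊢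
  generalize hA.eigenvalues 0 = x at *
  generalize hA.eigenvalues 1 = y at *
  generalize hA.eigenvalues 2 = z at *
  obtain rfl : z = -x - y := by linarith
  nlinarith [sq_nonneg ((x - y) * (y - (-x - y)) * ((-x - y) - x))]

/-- `s*` is the positive root of `2 c s² - b s - 3 a`. -/
lemma sstar_pos_and_root {a b c : ℝ} (ha : 0 < a) (hb : 0 < b) (hc : 0 < c) :
    0 < sstar a b c ∧ 2 * c * sstar a b c ^ 2 - b * sstar a b c - 3 * a = 0 := by
  have hD := Real.sq_sqrt (show 0 ≤ b ^ 2 + 24 * a * c by positivity)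
  refine ⟨by unfold sstar; positivity, ?_⟩
  unfold sstar
  generalize √(b ^ 2 + 24 * a * c) = d at *
  field_simp
  linear_combination 2 * hD

/-- Radial monotonicity of the bulk potential along the uniaxial profile beyond `s*`. -/
lemma uniaxial_profile_lt {a b c s r : ℝ} (ha : 0 < a) (hc : 0 < c)
    (hr : 0 < r) (hroot : 2 * c * r ^ 2 - b * r - 3 * a = 0) (hrs : r < s) :
    0 < -(a / 3) * (s ^ 2 - r ^ 2) - 2 * b / 27 * (s ^ 3 - r ^ 3)
      + c / 9 * (s ^ 4 - r ^ 4) := by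
  have hb : b < 2 * c * r := by
    by_contra! h
    nlinarith
  have key : 0 < c * (s + r) ^ 2 / 9 - b * (r + 2 * s) / 27 := by
    have h : b * (r + 2 * s) < 2 * c * r * (r + 2 * s) := by gcongr; linarith
    have : 0 < c * (3 * s ^ 2 + 2 * r * s + r ^ 2) := by
      have := hr.trans hrs
      positivity
    linarith
  have := mul_pos (pow_pos (sub_pos.2 hrs) 2) key
  linear_combination this + (r ^ 2 - s ^ 2) / 9 * hroot

/-- For the constant `C` normalizing `min f = 0` on `Sym₀`: whenever `|Q| > √(2/3) s*`,
radially truncating `Q` to the ball of radius `√(2/3) s*` strictly decreases `f`. -/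
theorem statement2 (a b c C : ℝ) (ha : 0 < a) (hb : 0 < b) (hc : 0 < c)
    (hC0 : ∀ Q ∈ Sym0, 0 ≤ fLdG a b c C Q)
    (hC1 : ∃ Q ∈ Sym0, fLdG a b c C Q = 0) :
    ∀ Q ∈ Sym0, Real.sqrt (2 / 3) * sstar a b c < nrm Q →
      fLdG a b c C ((Real.sqrt (2 / 3) * sstar a b c / nrm Q) • Q) < fLdG a b c C Q := by
  intro Q hQ hlt
  obtain ⟨hr, hroot⟩ := sstar_pos_and_root ha hb hc
  set r := sstar a b c
  have hq : 0 < √(2 / 3 : ℝ) := by positivity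
  have hq2 : √(2 / 3 : ℝ) ^ 2 = 2 / 3 := Real.sq_sqrt (by norm_num)
  obtain ⟨s, hs⟩ : ∃ s, nrm Q = √(2 / 3) * s := ⟨nrm Q / √(2 / 3), by field_simp⟩
  rw [hs] at hlt ⊢
  have hrs : r < s := lt_of_mul_lt_mul_left hlt hq.le
  have hs0 : 0 < s := hr.trans hrs
  have ht : (Q * Q).trace = 2 / 3 * s ^ 2 := by
    have hn : 0 < nrm Q := hs ▸ mul_pos hq hs0
    rw [← Real.sq_sqrt (Real.sqrt_pos.1 hn).le, show √(Q * Q).trace = nrm Q from rfl, hs,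
      mul_pow, hq2]
  have hT : (Q * Q * Q).trace ≤ 2 / 9 * s ^ 3 := by
    have h6 := six_mul_sq_trace_cube_le hQ
    rw [ht] at h6
    exact le_of_sq_le_sq (by linarith) (by positivity)
  rw [mul_div_mul_left _ _ hq.ne']
  simp only [fLdG, Matrix.smul_mul, Matrix.mul_smul, Matrix.trace_smul, smul_eq_mul, ht]
  generalize (Q * Q * Q).trace = T at *
  have hT' : T - (r / s) ^ 3 * T ≤ 2 / 9 * (s ^ 3 - r ^ 3) := by
    have h1 : 0 ≤ 1 - (r / s) ^ 3 :=
      sub_nonneg.2 (pow_le_one₀ (by positivity) ((div_le_one hs0).2 hrs.le))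
    calc T - (r / s) ^ 3 * T = T * (1 - (r / s) ^ 3) := by ring
      _ ≤ 2 / 9 * s ^ 3 * (1 - (r / s) ^ 3) := by gcongr
      _ = 2 / 9 * (s ^ 3 - r ^ 3) := by field_simp
  have hu : r / s * (r / s * (2 / 3 * s ^ 2)) = 2 / 3 * r ^ 2 := by field_simp
  have hprof := uniaxial_profile_lt ha hc hr hroot hrs
  have hbT := mul_le_mul_of_nonneg_left hT' (show 0 ≤ b / 3 by positivity)
  rw [hu]
  linear_combination hprof + hbT

end
end

section
/- For every Q ∈ Sym₀ there exist s ∈ [0, ∞), r ∈ [0, 1] and orthonormal vectors n, m ∈ ℝ³ that are eigenvectors of Q such that Q = s·( (n⊗n − (1/3)Id) + r·(m⊗m − (1/3)Id) ); one may take s = 2λ₁ + λ₂ and (when s ≠ 0) r = (λ₁ + 2λ₂)/s, where λ₁ ≥ λ₂ are the two largest eigenvalues of Q. Moreover the map Q ↦ s(Q) = 2λ₁(Q) + λ₂(Q) is continuous on Sym₀ and the map Q ↦ r(Q) = (λ₁(Q) + 2λ₂(Q))/s(Q) is continuous on Sym₀ ∖ {0}. -/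
open Matrix

noncomputable section

/-- The largest eigenvalue `λ₁(Q)` of a symmetric matrix `Q`, characterized as the maximum of the
quadratic form `v ↦ vᵀ Q v` over unit vectors `v`. -/
def lam1 (Q : Matrix (Fin 3) (Fin 3) ℝ) : ℝ :=
  sSup {x : ℝ | ∃ v : Fin 3 → ℝ, v ⬝ᵥ v = 1 ∧ x = v ⬝ᵥ Q.mulVec v}

/-- The smallest eigenvalue `λ₃(Q)` of a symmetric matrix `Q`, characterized as the minimum of the
quadratic form `v ↦ vᵀ Q v` over unit vectors `v`. -/
def lam3 (Q : Matrix (Fin 3) (Fin 3) ℝ) : ℝ :=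
  sInf {x : ℝ | ∃ v : Fin 3 → ℝ, v ⬝ᵥ v = 1 ∧ x = v ⬝ᵥ Q.mulVec v}

/-- The middle eigenvalue `λ₂(Q) = tr Q - λ₁(Q) - λ₃(Q)` of a symmetric matrix `Q`. -/
def lam2 (Q : Matrix (Fin 3) (Fin 3) ℝ) : ℝ := Q.trace - lam1 Q - lam3 Q

lemma dotProduct_outer_mulVec (e v : Fin 3 → ℝ) : v ⬝ᵥ (outer e).mulVec v = (e ⬝ᵥ v) ^ 2 := by
  simp only [outer, dotProduct, mulVec, Fin.sum_univ_three, of_apply]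
  ring

lemma trace_outer (e : Fin 3 → ℝ) : (outer e).trace = e ⬝ᵥ e := by
  simp [outer, trace, dotProduct]

/-- A symmetric matrix has an orthonormal basis of eigenvectors, ordered by decreasing
eigenvalue. -/
lemma exists_ordered_eigenbasis {Q : Matrix (Fin 3) (Fin 3) ℝ} (hQ : Q.IsSymm) :
    ∃ (μ : Fin 3 → ℝ) (e : Fin 3 → Fin 3 → ℝ), Antitone μ ∧
      (∀ i j, e i ⬝ᵥ e j = if i = j then 1 else 0) ∧ (∀ i, Q.mulVec (e i) = μ i • e i) := by
  have hH : Q.IsHermitian := by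
    rw [IsHermitian, conjTranspose_eq_transpose_of_trivial]
    exact hQ
  let σ := Tuple.sort fun i => -hH.eigenvalues i
  refine ⟨hH.eigenvalues ∘ σ, fun i => hH.eigenvectorBasis (σ i), ?_, ?_, ?_⟩
  · intro i j hij
    have := Tuple.monotone_sort (fun i => -hH.eigenvalues i) hij
    simpa using this
  · intro i j
    have := orthonormal_iff_ite.mp hH.eigenvectorBasis.orthonormal (σ j) (σ i)
    simpa [EuclideanSpace.inner_eq_star_dotProduct, eq_comm] using this
  · intro i
    exact hH.mulVec_eigenvectorBasis (σ i)

section Eigenbasis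

variable {Q : Matrix (Fin 3) (Fin 3) ℝ} {μ : Fin 3 → ℝ} {e : Fin 3 → Fin 3 → ℝ}

lemma sum_outer_eq_one (he : ∀ i j, e i ⬝ᵥ e j = if i = j then 1 else 0) :
    ∑ i, outer (e i) = 1 := by
  have h : (of e) * (of e)ᵀ = 1 := by
    ext i j
    rw [one_apply, ← he i j]
    rfl
  rw [← mul_eq_one_comm.mp h]
  ext i j
  simp [outer, mul_apply, Matrix.sum_apply]

lemma eq_sum_smul_outer (he : ∀ i j, e i ⬝ᵥ e j = if i = j then 1 else 0)
    (hμ : ∀ i, Q.mulVec (e i) = μ i • e i) : Q = ∑ i, μ i • outer (e i) := by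
  have h (i : Fin 3) : Q * outer (e i) = μ i • outer (e i) := by
    ext j k
    have := congrFun (hμ i) j
    simp only [mulVec, dotProduct, Pi.smul_apply, smul_eq_mul] at this
    simp only [mul_apply, outer, of_apply, Matrix.smul_apply, smul_eq_mul]
    rw [← mul_assoc, ← this, Finset.sum_mul]
    simp only [mul_assoc]
  calc Q = Q * ∑ i, outer (e i) := by rw [sum_outer_eq_one he, mul_one]
    _ = _ := by simp only [Finset.mul_sum, h]

lemma sum_sq_dotProduct (he : ∀ i j, e i ⬝ᵥ e j = if i = j then 1 else 0) (v : Fin 3 → ℝ) :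
    ∑ i, (e i ⬝ᵥ v) ^ 2 = v ⬝ᵥ v := by
  simp_rw [← dotProduct_outer_mulVec, ← dotProduct_sum, ← sum_mulVec, sum_outer_eq_one he,
    one_mulVec]

lemma dotProduct_mulVec_eq_sum (he : ∀ i j, e i ⬝ᵥ e j = if i = j then 1 else 0)
    (hμ : ∀ i, Q.mulVec (e i) = μ i • e i) (v : Fin 3 → ℝ) :
    v ⬝ᵥ Q.mulVec v = ∑ i, μ i * (e i ⬝ᵥ v) ^ 2 := by
  simp_rw [← dotProduct_outer_mulVec, ← smul_eq_mul, ← dotProduct_smul, ← smul_mulVec,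
    ← dotProduct_sum, ← sum_mulVec, ← eq_sum_smul_outer he hμ]

lemma dotProduct_mulVec_eigenvector (he : ∀ i j, e i ⬝ᵥ e j = if i = j then 1 else 0)
    (hμ : ∀ i, Q.mulVec (e i) = μ i • e i) (i : Fin 3) : e i ⬝ᵥ Q.mulVec (e i) = μ i := by
  simp [hμ, he]

lemma lam1_eq (hanti : Antitone μ) (he : ∀ i j, e i ⬝ᵥ e j = if i = j then 1 else 0)
    (hμ : ∀ i, Q.mulVec (e i) = μ i • e i) : lam1 Q = μ 0 := by
  refine IsGreatest.csSup_eq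
    ⟨⟨e 0, by simp [he], (dotProduct_mulVec_eigenvector he hμ 0).symm⟩, ?_⟩
  rintro x ⟨v, hv, rfl⟩
  rw [dotProduct_mulVec_eq_sum he hμ, ← mul_one (μ 0), ← hv, ← sum_sq_dotProduct he,
    Finset.mul_sum]
  gcongr with i
  exact hanti (Fin.zero_le i)

lemma lam3_eq (hanti : Antitone μ) (he : ∀ i j, e i ⬝ᵥ e j = if i = j then 1 else 0)
    (hμ : ∀ i, Q.mulVec (e i) = μ i • e i) : lam3 Q = μ 2 := by
  refine IsLeast.csInf_eq
    ⟨⟨e 2, by simp [he], (dotProduct_mulVec_eigenvector he hμ 2).symm⟩, ?_⟩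
  rintro x ⟨v, hv, rfl⟩
  rw [dotProduct_mulVec_eq_sum he hμ, ← mul_one (μ 2), ← hv, ← sum_sq_dotProduct he,
    Finset.mul_sum]
  gcongr with i
  exact hanti (Fin.le_last i)

lemma trace_eq_sum (he : ∀ i j, e i ⬝ᵥ e j = if i = j then 1 else 0)
    (hμ : ∀ i, Q.mulVec (e i) = μ i • e i) : Q.trace = ∑ i, μ i := by
  rw [eq_sum_smul_outer he hμ]
  simp [trace_sum, trace_outer, he]

lemma lam2_eq (hanti : Antitone μ) (he : ∀ i j, e i ⬝ᵥ e j = if i = j then 1 else 0)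
    (hμ : ∀ i, Q.mulVec (e i) = μ i • e i) : lam2 Q = μ 1 := by
  rw [lam2, lam1_eq hanti he hμ, lam3_eq hanti he hμ, trace_eq_sum he hμ, Fin.sum_univ_three]
  ring

end Eigenbasis

lemma exists_biaxial_decomposition {Q : Matrix (Fin 3) (Fin 3) ℝ} (hQ : Q ∈ Sym0) :
    ∃ (s r : ℝ) (n m : Fin 3 → ℝ),
      0 ≤ s ∧ 0 ≤ r ∧ r ≤ 1 ∧
      n ⬝ᵥ n = 1 ∧ m ⬝ᵥ m = 1 ∧ n ⬝ᵥ m = 0 ∧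
      (∃ μ : ℝ, Q.mulVec n = μ • n) ∧ (∃ μ : ℝ, Q.mulVec m = μ • m) ∧
      Q = s • ((outer n - (1 / 3 : ℝ) • (1 : Matrix (Fin 3) (Fin 3) ℝ)) +
          r • (outer m - (1 / 3 : ℝ) • (1 : Matrix (Fin 3) (Fin 3) ℝ))) ∧
      s = 2 * lam1 Q + lam2 Q ∧
      (s ≠ 0 → r = (lam1 Q + 2 * lam2 Q) / s) := by
  obtain ⟨hsymm, htr⟩ := hQ
  obtain ⟨μ, e, hanti, he, hμ⟩ := exists_ordered_eigenbasis hsymm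
  have h01 : μ 1 ≤ μ 0 := hanti (by decide)
  have h12 : μ 2 ≤ μ 1 := hanti (by decide)
  rw [trace_eq_sum he hμ, Fin.sum_univ_three] at htr
  have hsr : (2 * μ 0 + μ 1) * ((μ 0 + 2 * μ 1) / (2 * μ 0 + μ 1)) = μ 0 + 2 * μ 1 := by
    refine mul_div_cancel_of_imp' fun h => ?_
    linarith
  refine ⟨2 * μ 0 + μ 1, (μ 0 + 2 * μ 1) / (2 * μ 0 + μ 1), e 0, e 1, by linarith,
    div_nonneg (by linarith) (by linarith), div_le_one_of_le₀ (by linarith) (by linarith),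
    by simp [he], by simp [he], by simp [he], ⟨_, hμ 0⟩, ⟨_, hμ 1⟩, ?_, ?_, ?_⟩
  · have hone := sum_outer_eq_one he
    rw [Fin.sum_univ_three] at hone
    rw [smul_add, smul_smul, hsr]
    conv_lhs => rw [eq_sum_smul_outer he hμ, Fin.sum_univ_three]
    have hμ2 : μ 2 = -(μ 0 + μ 1) := by linarith
    rw [← hone, hμ2]
    module
  · rw [lam1_eq hanti he hμ, lam2_eq hanti he hμ]
  · intro _
    rw [lam1_eq hanti he hμ, lam2_eq hanti he hμ]

lemma isCompact_unitSphere : IsCompact {v : Fin 3 → ℝ | v ⬝ᵥ v = 1} := by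
  refine (isCompact_closedBall (0 : Fin 3 → ℝ) 1).of_isClosed_subset
    (isClosed_eq (by fun_prop) continuous_const) fun v hv => ?_
  rw [mem_closedBall_zero_iff, pi_norm_le_iff_of_nonneg zero_le_one]
  intro i
  rw [Real.norm_eq_abs, ← sq_le_one_iff_abs_le_one, ← show v ⬝ᵥ v = 1 from hv, dotProduct, sq]
  exact Finset.single_le_sum (f := fun j => v j * v j) (fun j _ => mul_self_nonneg _)
    (Finset.mem_univ i)

lemma quadraticForm_values_eq_image (Q : Matrix (Fin 3) (Fin 3) ℝ) :
    {x : ℝ | ∃ v : Fin 3 → ℝ, v ⬝ᵥ v = 1 ∧ x = v ⬝ᵥ Q.mulVec v} =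
      (fun v => v ⬝ᵥ Q.mulVec v) '' {v : Fin 3 → ℝ | v ⬝ᵥ v = 1} := by
  ext x
  simp [eq_comm]

lemma continuous_lam1 : Continuous lam1 := by
  unfold lam1
  simp_rw [quadraticForm_values_eq_image]
  exact isCompact_unitSphere.continuous_sSup (by fun_prop)

lemma continuous_lam3 : Continuous lam3 := by
  unfold lam3
  simp_rw [quadraticForm_values_eq_image]
  exact isCompact_unitSphere.continuous_sInf (by fun_prop)

lemma continuous_lam2 : Continuous lam2 :=
  (continuous_id.matrix_trace.sub continuous_lam1).sub continuous_lam3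

/-- Every `Q ∈ Sym₀` decomposes as `Q = s ((n⊗n - Id/3) + r (m⊗m - Id/3))` with `s ≥ 0`,
`r ∈ [0,1]` and `n, m` orthonormal eigenvectors of `Q`; one may take `s = 2λ₁ + λ₂` and (when
`s ≠ 0`) `r = (λ₁ + 2λ₂)/s`.  Moreover `Q ↦ 2λ₁(Q) + λ₂(Q)` is continuous on `Sym₀` and
`Q ↦ (λ₁(Q) + 2λ₂(Q))/(2λ₁(Q) + λ₂(Q))` is continuous on `Sym₀ ∖ {0}`. -/
theorem statement5 :
    (∀ Q ∈ Sym0,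
      ∃ (s r : ℝ) (n m : Fin 3 → ℝ),
        0 ≤ s ∧ 0 ≤ r ∧ r ≤ 1 ∧
        n ⬝ᵥ n = 1 ∧ m ⬝ᵥ m = 1 ∧ n ⬝ᵥ m = 0 ∧
        (∃ μ : ℝ, Q.mulVec n = μ • n) ∧ (∃ μ : ℝ, Q.mulVec m = μ • m) ∧
        Q = s • ((outer n - (1 / 3 : ℝ) • (1 : Matrix (Fin 3) (Fin 3) ℝ)) +
            r • (outer m - (1 / 3 : ℝ) • (1 : Matrix (Fin 3) (Fin 3) ℝ))) ∧
        s = 2 * lam1 Q + lam2 Q ∧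
        (s ≠ 0 → r = (lam1 Q + 2 * lam2 Q) / s)) ∧
    ContinuousOn (fun Q : Matrix (Fin 3) (Fin 3) ℝ => 2 * lam1 Q + lam2 Q) Sym0 ∧
    ContinuousOn (fun Q : Matrix (Fin 3) (Fin 3) ℝ =>
      (lam1 Q + 2 * lam2 Q) / (2 * lam1 Q + lam2 Q)) (Sym0 \ {0}) := by
  have h1 := continuous_lam1
  have h2 := continuous_lam2
  refine ⟨fun Q hQ => exists_biaxial_decomposition hQ, by fun_prop,
    ContinuousOn.div (by fun_prop) (by fun_prop) ?_⟩
  rintro Q ⟨hQ, hQ0⟩ hs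
  obtain ⟨s, r, n, m, -, -, -, -, -, -, -, -, hdecomp, hs', -⟩ := exists_biaxial_decomposition hQ
  rw [hs', hs, zero_smul] at hdecomp
  exact hQ0 hdecomp

end
end

section
/- Let Q ∈ Sym₀ ∖ 𝒞, i.e. the largest eigenvalue λ₁(Q) of Q is strictly larger than the second eigenvalue λ₂(Q), and let n be a unit eigenvector of Q for λ₁(Q). Then P = s*(n⊗n − (1/3)Id) is a nearest point of N to Q: for every P' ∈ N one has |Q − P| ≤ |Q − P'|. -/
open Matrix

noncomputable section

theorem trace_sub_uniax_sq {Q : Matrix (Fin 3) (Fin 3) ℝ} (hQ : Q.IsSymm) (s : ℝ)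
    {m : Fin 3 → ℝ} (hm : m ⬝ᵥ m = 1) :
    ((Q - uniax s m) * (Q - uniax s m)).trace =
      (Q * Q).trace - 2 * s * (m ⬝ᵥ Q.mulVec m - Q.trace / 3) + 2 / 3 * s ^ 2 := by
  have h01 : Q 1 0 = Q 0 1 := hQ.apply 0 1
  have h02 : Q 2 0 = Q 0 2 := hQ.apply 0 2
  have h12 : Q 2 1 = Q 1 2 := hQ.apply 1 2
  simp only [dotProduct, Fin.sum_univ_three] at hm
  simp [uniax, outer, Matrix.trace, Matrix.mul_apply, Fin.sum_univ_three, dotProduct,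
    Matrix.mulVec, Matrix.one_apply, h01, h02, h12]
  linear_combination (s ^ 2 * (m 0 * m 0 + m 1 * m 1 + m 2 * m 2 + 1 / 3)) * hm

theorem bddAbove_quadraticForm_unit (Q : Matrix (Fin 3) (Fin 3) ℝ) :
    BddAbove {x : ℝ | ∃ v : Fin 3 → ℝ, v ⬝ᵥ v = 1 ∧ x = v ⬝ᵥ Q.mulVec v} := by
  refine ⟨∑ i, ∑ j, |Q i j|, ?_⟩
  rintro x ⟨v, hv, rfl⟩
  have hv1 (i : Fin 3) : |v i| ≤ 1 := by
    rw [← sq_le_one_iff_abs_le_one, ← hv, sq]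
    exact Finset.single_le_sum (f := fun i => v i * v i)
      (fun j _ => mul_self_nonneg (v j)) (Finset.mem_univ i)
  simp only [dotProduct, Matrix.mulVec, Finset.mul_sum]
  refine Finset.sum_le_sum fun i _ => Finset.sum_le_sum fun j _ => ?_
  calc v i * (Q i j * v j) ≤ |v i * (Q i j * v j)| := le_abs_self _
    _ = |v i| * (|Q i j| * |v j|) := by rw [abs_mul, abs_mul]
    _ ≤ 1 * (|Q i j| * 1) := by gcongr <;> exact hv1 _
    _ = |Q i j| := by ring

theorem dotProduct_mulVec_le_lam1 (Q : Matrix (Fin 3) (Fin 3) ℝ) {v : Fin 3 → ℝ}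
    (hv : v ⬝ᵥ v = 1) : v ⬝ᵥ Q.mulVec v ≤ lam1 Q :=
  le_csSup (bddAbove_quadraticForm_unit Q) ⟨v, hv, rfl⟩

theorem sstar_nonneg {b c : ℝ} (a : ℝ) (hb : 0 ≤ b) (hc : 0 ≤ c) : 0 ≤ sstar a b c := by
  unfold sstar
  positivity

/-- If `Q ∈ Sym₀` is outside the biaxial cone (`λ₁(Q) > λ₂(Q)`) and `n` is a unit eigenvector of
`Q` for `λ₁(Q)`, then `P = s*(n⊗n - Id/3)` is a nearest point of `N` to `Q`. -/
theorem statement6 (a b c : ℝ) (ha : 0 < a) (hb : 0 < b) (hc : 0 < c)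
    (Q : Matrix (Fin 3) (Fin 3) ℝ) (hQ : Q ∈ Sym0)
    (hsimple : lam2 Q < lam1 Q)
    (n : Fin 3 → ℝ) (hn : n ⬝ᵥ n = 1) (heig : Q.mulVec n = lam1 Q • n) :
    ∀ P' ∈ Nset a b c, nrm (Q - uniax (sstar a b c) n) ≤ nrm (Q - P') := by
  rintro _ ⟨m, hm, rfl⟩
  have hm' : m ⬝ᵥ m = 1 := by
    rw [← hm, dotProduct, Fin.sum_univ_three]
    ring
  have hnQ : n ⬝ᵥ Q.mulVec n = lam1 Q := by
    rw [heig, dotProduct_smul, hn, smul_eq_mul, mul_one]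
  refine Real.sqrt_le_sqrt ?_
  rw [trace_sub_uniax_sq hQ.1 _ hn, trace_sub_uniax_sq hQ.1 _ hm', hnQ]
  have := sstar_nonneg a hb.le hc.le
  gcongr
  exact dotProduct_mulVec_le_lam1 Q hm'

end
end

section
/- For every Q ∈ Sym₀ one has g(Q) ≥ 0, and g(Q) = 0 if and only if Q = t·(e₃⊗e₃ − (1/3)Id) for some t ≥ 0, where e₃ = (0,0,1). -/
open Matrix

noncomputable section

/-- The magnetic potential `g(Q) = √(2/3) - Q₃₃/|Q|` (with `g(0) = 0`). -/
def gfun (Q : Matrix (Fin 3) (Fin 3) ℝ) : ℝ :=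
  if Q = 0 then 0 else Real.sqrt (2 / 3) - Q 2 2 / nrm Q

theorem trace_mul_self_of_mem_Sym0 {Q : Matrix (Fin 3) (Fin 3) ℝ} (hQ : Q ∈ Sym0) :
    (Q * Q).trace = 3 / 2 * Q 2 2 ^ 2 +
      ((Q 0 0 - Q 1 1) ^ 2 / 2 + 2 * (Q 0 1 ^ 2 + Q 0 2 ^ 2 + Q 1 2 ^ 2)) := by
  obtain ⟨hs, ht⟩ := hQ
  have h22 : Q 2 2 = -(Q 0 0 + Q 1 1) := by
    rw [Matrix.trace_fin_three] at ht
    linarith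
  rw [Matrix.trace_fin_three]
  simp only [Matrix.mul_apply, Fin.sum_univ_three, hs.apply 0 1, hs.apply 0 2, hs.apply 1 2, h22]
  ring

theorem sqrt_two_thirds_mul_nrm (Q : Matrix (Fin 3) (Fin 3) ℝ) :
    Real.sqrt (2 / 3) * nrm Q = Real.sqrt (2 / 3 * (Q * Q).trace) :=
  (Real.sqrt_mul (by norm_num) _).symm

theorem apply_two_two_le {Q : Matrix (Fin 3) (Fin 3) ℝ} (hQ : Q ∈ Sym0) :
    Q 2 2 ≤ Real.sqrt (2 / 3) * nrm Q := by
  rw [sqrt_two_thirds_mul_nrm, trace_mul_self_of_mem_Sym0 hQ]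
  apply Real.le_sqrt_of_sq_le
  nlinarith [sq_nonneg (Q 0 0 - Q 1 1), sq_nonneg (Q 0 1), sq_nonneg (Q 0 2), sq_nonneg (Q 1 2)]

theorem nrm_pos {Q : Matrix (Fin 3) (Fin 3) ℝ} (hQ : Q ∈ Sym0) (h0 : Q ≠ 0) : 0 < nrm Q := by
  refine Real.sqrt_pos.2 ?_
  have hpos := (Matrix.posSemidef_conjTranspose_mul_self Q).trace_nonneg
  have hzero := Matrix.trace_conjTranspose_mul_self_eq_zero_iff (A := Q)
  rw [Matrix.conjTranspose_eq_transpose_of_trivial, hQ.1.eq] at hpos hzero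
  exact lt_of_le_of_ne hpos fun h => h0 (hzero.1 h.symm)

theorem apply_two_two_eq_iff {Q : Matrix (Fin 3) (Fin 3) ℝ} (hQ : Q ∈ Sym0) :
    Q 2 2 = Real.sqrt (2 / 3) * nrm Q ↔ ∃ t : ℝ, 0 ≤ t ∧
      Q = t • (outer ![0, 0, 1] - (1 / 3 : ℝ) • (1 : Matrix (Fin 3) (Fin 3) ℝ)) := by
  rw [sqrt_two_thirds_mul_nrm, trace_mul_self_of_mem_Sym0 hQ]
  constructor
  · intro h
    have hnonneg : 0 ≤ Q 2 2 := h ▸ Real.sqrt_nonneg _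
    have hsq := Real.sq_sqrt (x := 2 / 3 * (3 / 2 * Q 2 2 ^ 2 +
      ((Q 0 0 - Q 1 1) ^ 2 / 2 + 2 * (Q 0 1 ^ 2 + Q 0 2 ^ 2 + Q 1 2 ^ 2)))) (by positivity)
    rw [← h] at hsq
    have hd := sq_nonneg (Q 0 0 - Q 1 1)
    have hx := sq_nonneg (Q 0 1)
    have hy := sq_nonneg (Q 0 2)
    have hz := sq_nonneg (Q 1 2)
    have h01 : Q 0 1 = 0 := pow_eq_zero_iff two_ne_zero |>.1 (by linarith)
    have h02 : Q 0 2 = 0 := pow_eq_zero_iff two_ne_zero |>.1 (by linarith)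
    have h12 : Q 1 2 = 0 := pow_eq_zero_iff two_ne_zero |>.1 (by linarith)
    have hdiag : Q 0 0 - Q 1 1 = 0 := pow_eq_zero_iff two_ne_zero |>.1 (by linarith)
    obtain ⟨hs, ht⟩ := hQ
    rw [Matrix.trace_fin_three] at ht
    refine ⟨3 / 2 * Q 2 2, by positivity, ?_⟩
    ext i j
    fin_cases i <;> fin_cases j <;>
      simp [outer, h01, h02, h12, hs.apply 0 1, hs.apply 0 2, hs.apply 1 2] <;> linarith
  · rintro ⟨t, ht, rfl⟩
    rw [eq_comm, Real.sqrt_eq_iff_mul_self_eq (by positivity)] <;> simp [outer]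
    · ring
    · linarith

/-- For every `Q ∈ Sym₀` one has `g(Q) ≥ 0`, with equality exactly when
`Q = t (e₃ ⊗ e₃ - Id/3)` for some `t ≥ 0`. -/
theorem statement7 :
    ∀ Q ∈ Sym0, 0 ≤ gfun Q ∧
      (gfun Q = 0 ↔ ∃ t : ℝ, 0 ≤ t ∧
        Q = t • (outer ![0, 0, 1] - (1 / 3 : ℝ) • (1 : Matrix (Fin 3) (Fin 3) ℝ))) := by
  intro Q hQ
  by_cases h0 : Q = 0
  · have hg : gfun Q = 0 := if_pos h0
    exact ⟨hg.ge, fun _ => ⟨0, le_rfl, by rw [h0, zero_smul]⟩, fun _ => hg⟩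
  · have hN := nrm_pos hQ h0
    rw [gfun, if_neg h0, sub_nonneg, div_le_iff₀ hN, sub_eq_zero, eq_comm, div_eq_iff hN.ne',
      apply_two_two_eq_iff hQ]
    exact ⟨apply_two_two_le hQ, Iff.rfl⟩

end
end

section
/- For all 0 ≤ r₁ < r₂ ≤ ∞ and every admissible profile n₃ on [r₁, r₂] with n₃(r₁) = −1 and n₃(r₂) = 1, one has J(n₃) ≥ 2·24^{1/4}·s*; in particular I(r₁, r₂, −1, 1) ≥ 2·24^{1/4}·s*. -/
open MeasureTheory Set Filter
open scoped ENNReal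

noncomputable section

/-- The (real) domain corresponding to the interval `[r₁, r₂] ⊂ [0, ∞]` of (possibly infinite)
radii. -/
def dom (r₁ r₂ : ℝ≥0∞) : Set ℝ :=
  {x : ℝ | 0 ≤ x ∧ r₁ ≤ ENNReal.ofReal x ∧ ENNReal.ofReal x ≤ r₂}

/-- An admissible profile on `[r₁, r₂]` with boundary values `a`, `b`: an absolutely continuous
function `m : [r₁, r₂] → [-1, 1]` (encoded by the fundamental theorem of calculus with an
integrable derivative `d`) with `m(r₁) = a` and `m(r₂) = b`, boundary conditions at an infinite
endpoint being understood as limits. -/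
def Adm (r₁ r₂ : ℝ≥0∞) (a b : ℝ) (m d : ℝ → ℝ) : Prop :=
  (∀ x ∈ dom r₁ r₂, m x ∈ Icc (-1 : ℝ) 1) ∧
  (if r₁ = ⊤ then Tendsto m atTop (nhds a) else m r₁.toReal = a) ∧
  (if r₂ = ⊤ then Tendsto m atTop (nhds b) else m r₂.toReal = b) ∧
  (∀ x ∈ dom r₁ r₂, ∀ y ∈ dom r₁ r₂,
    IntervalIntegrable d volume x y ∧ m y - m x = ∫ t in x..y, d t)

/-- The transition energy `J(m) = ∫_{r₁}^{r₂} ( s*² m'²/(1 - m²) + √(3/2)(1 - m²) ) dr` of a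
profile `m` with derivative `d`, valued in `[0, ∞]`; the convention that the first term is `+∞`
where `|m| = 1` and `m' ≠ 0` is implemented by the `ℝ≥0∞`-valued division. -/
def ener (s : ℝ) (m d : ℝ → ℝ) (r₁ r₂ : ℝ≥0∞) : ℝ≥0∞ :=
  ∫⁻ t in dom r₁ r₂,
    ENNReal.ofReal (s ^ 2 * d t ^ 2) / ENNReal.ofReal (1 - m t ^ 2) +
      ENNReal.ofReal (Real.sqrt (3 / 2) * (1 - m t ^ 2))

/-- `I(r₁, r₂, a, b)`: the infimum of the transition energy over admissible profiles. -/
def Ival (s : ℝ) (r₁ r₂ : ℝ≥0∞) (a b : ℝ) : ℝ≥0∞ :=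
  ⨅ (m : ℝ → ℝ) (d : ℝ → ℝ) (_ : Adm r₁ r₂ a b m d), ener s m d r₁ r₂

lemma ofReal_mul_enorm_le_energy_density {s c B x : ℝ} (hs : 0 ≤ s) (hc : 0 ≤ c) (hB : 0 ≤ B) :
    ENNReal.ofReal (2 * s * Real.sqrt c) * ‖x‖ₑ ≤
      ENNReal.ofReal (s ^ 2 * x ^ 2) / ENNReal.ofReal B + ENNReal.ofReal (c * B) := by
  have hK : 0 ≤ 2 * s * Real.sqrt c := by positivity
  rw [Real.enorm_eq_ofReal_abs, ← ENNReal.ofReal_mul hK]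
  rcases hB.eq_or_lt with rfl | hB
  · by_cases h : s ^ 2 * x ^ 2 = 0
    · have h' : s * |x| = 0 := by
        have h2 : (s * |x|) ^ 2 = 0 := by rw [mul_pow, sq_abs, h]
        exact pow_eq_zero_iff two_ne_zero |>.mp h2
      have : 2 * s * Real.sqrt c * |x| = 0 := by linear_combination 2 * Real.sqrt c * h'
      simp [this]
    · have h' : 0 < s ^ 2 * x ^ 2 := lt_of_le_of_ne (by positivity) (Ne.symm h)
      rw [ENNReal.ofReal_zero, ENNReal.div_zero (by simpa using h'), top_add]
      exact le_top
  · rw [← ENNReal.ofReal_div_of_pos hB, ← ENNReal.ofReal_add (by positivity) (by positivity)]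
    apply ENNReal.ofReal_le_ofReal
    rw [div_add' _ _ _ hB.ne', le_div_iff₀ hB]
    have hsq : (s * |x| - Real.sqrt c * B) ^ 2 =
        s ^ 2 * x ^ 2 + c * B * B - 2 * s * Real.sqrt c * |x| * B := by
      linear_combination s ^ 2 * sq_abs x + B ^ 2 * Real.sq_sqrt hc
    linarith [sq_nonneg (s * |x| - Real.sqrt c * B)]

lemma ofReal_mul_sub_le_ener {s a b : ℝ} (hs : 0 ≤ s) {r₁ r₂ : ℝ≥0∞} {m d : ℝ → ℝ}
    (h : Adm r₁ r₂ a b m d) {x y : ℝ} (hx : x ∈ dom r₁ r₂) (hy : y ∈ dom r₁ r₂) (hxy : x ≤ y) :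
    ENNReal.ofReal (2 * s * Real.sqrt (Real.sqrt (3 / 2)) * (m y - m x)) ≤ ener s m d r₁ r₂ := by
  obtain ⟨hm, -, -, hftc⟩ := h
  have hsub : Ioc x y ⊆ dom r₁ r₂ := fun t ht =>
    ⟨hx.1.trans ht.1.le, hx.2.1.trans (ENNReal.ofReal_le_ofReal ht.1.le),
      (ENNReal.ofReal_le_ofReal ht.2).trans hy.2.2⟩
  have hK : 0 ≤ 2 * s * Real.sqrt (Real.sqrt (3 / 2)) := by positivity
  rw [ENNReal.ofReal_mul hK, (hftc x hx y hy).2, intervalIntegral.integral_of_le hxy]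
  calc _ ≤ ENNReal.ofReal (2 * s * Real.sqrt (Real.sqrt (3 / 2))) * ∫⁻ t in Ioc x y, ‖d t‖ₑ := by
        gcongr
        refine le_trans ?_ (enorm_integral_le_lintegral_enorm _)
        rw [Real.enorm_eq_ofReal_abs]
        exact ENNReal.ofReal_le_ofReal (le_abs_self _)
    _ = ∫⁻ t in Ioc x y, ENNReal.ofReal (2 * s * Real.sqrt (Real.sqrt (3 / 2))) * ‖d t‖ₑ :=
        (lintegral_const_mul' _ _ ENNReal.ofReal_ne_top).symm
    _ ≤ ∫⁻ t in Ioc x y, (ENNReal.ofReal (s ^ 2 * d t ^ 2) / ENNReal.ofReal (1 - m t ^ 2) +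
          ENNReal.ofReal (Real.sqrt (3 / 2) * (1 - m t ^ 2))) := by
        refine setLIntegral_mono' measurableSet_Ioc fun t ht => ?_
        have hmt := hm t (hsub ht)
        exact ofReal_mul_enorm_le_energy_density hs (Real.sqrt_nonneg _)
          (by nlinarith [hmt.1, hmt.2])
    _ ≤ ener s m d r₁ r₂ := lintegral_mono_set hsub

lemma two_mul_rpow_mul_eq (s : ℝ) :
    2 * (24 : ℝ) ^ ((1 : ℝ) / 4) * s = 2 * s * Real.sqrt (Real.sqrt (3 / 2)) * (1 - -1) := by
  have h : (24 : ℝ) ^ ((1 : ℝ) / 4) = 2 * Real.sqrt (Real.sqrt (3 / 2)) := by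
    rw [Real.sqrt_eq_rpow, Real.sqrt_eq_rpow, ← Real.rpow_mul (by norm_num),
      show (24 : ℝ) = 2 ^ (4 : ℝ) * (3 / 2) by norm_num,
      Real.mul_rpow (by positivity) (by norm_num), ← Real.rpow_mul (by norm_num)]
    norm_num
  rw [h]
  ring

lemma ofReal_le_ener {s : ℝ} (hs : 0 ≤ s) {r₁ r₂ : ℝ≥0∞} (h12 : r₁ < r₂) {m d : ℝ → ℝ}
    (h : Adm r₁ r₂ (-1) 1 m d) :
    ENNReal.ofReal (2 * (24 : ℝ) ^ ((1 : ℝ) / 4) * s) ≤ ener s m d r₁ r₂ := by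
  have hr₁ : r₁ ≠ ⊤ := h12.ne_top
  have hx : r₁.toReal ∈ dom r₁ r₂ :=
    ⟨ENNReal.toReal_nonneg, (ENNReal.ofReal_toReal hr₁).ge,
      (ENNReal.ofReal_toReal hr₁).le.trans h12.le⟩
  have hmx : m r₁.toReal = -1 := by simpa [hr₁] using h.2.1
  have hmy := h.2.2.1
  rw [two_mul_rpow_mul_eq, ← hmx]
  split_ifs at hmy with hr₂
  · refine le_of_tendsto (ENNReal.tendsto_ofReal ((hmy.sub_const _).const_mul _)) ?_
    filter_upwards [eventually_ge_atTop r₁.toReal] with y hy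
    refine ofReal_mul_sub_le_ener hs h hx ⟨hx.1.trans hy, ?_, hr₂ ▸ le_top⟩ hy
    exact hx.2.1.trans (ENNReal.ofReal_le_ofReal hy)
  · rw [← hmy]
    refine ofReal_mul_sub_le_ener hs h hx ⟨ENNReal.toReal_nonneg, ?_, ?_⟩
      (ENNReal.toReal_mono hr₂ h12.le)
    · exact h12.le.trans (ENNReal.ofReal_toReal hr₂).ge
    · exact (ENNReal.ofReal_toReal hr₂).le

/-- Every admissible profile going from `-1` to `1` has transition energy at least
`2 ⁴√24 s*`; in particular `I(r₁, r₂, -1, 1) ≥ 2 ⁴√24 s*`. -/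
theorem statement13 (sStar : ℝ) (hs : 0 < sStar)
    (r₁ r₂ : ℝ≥0∞) (h12 : r₁ < r₂) :
    (∀ m d : ℝ → ℝ, Adm r₁ r₂ (-1) 1 m d →
      ENNReal.ofReal (2 * (24 : ℝ) ^ ((1 : ℝ) / 4) * sStar) ≤ ener sStar m d r₁ r₂) ∧
    ENNReal.ofReal (2 * (24 : ℝ) ^ ((1 : ℝ) / 4) * sStar) ≤ Ival sStar r₁ r₂ (-1) 1 := by
  have key : ∀ m d : ℝ → ℝ, Adm r₁ r₂ (-1) 1 m d →
      ENNReal.ofReal (2 * (24 : ℝ) ^ ((1 : ℝ) / 4) * sStar) ≤ ener sStar m d r₁ r₂ :=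
    fun _ _ h => ofReal_le_ener hs.le h12 h
  exact ⟨key, le_iInf fun m => le_iInf fun d => le_iInf fun h => key m d h⟩

end
end

section
/- Let θ ∈ (0, π), A = (1 + cos θ)/(1 − cos θ), and define n₃ : [0, ∞) → [−1, 1] by n₃(r) = (A − exp(−24^{1/4}·r/s*)) / (A + exp(−24^{1/4}·r/s*)). Then n₃(0) = cos θ, n₃(r) → 1 as r → ∞, the energy of this profile equals J(n₃) = 24^{1/4}·s*·(1 − cos θ), and every admissible profile m on [0, ∞) with m(0) = cos θ and m(r) → 1 as r → ∞ satisfies J(m) ≥ 24^{1/4}·s*·(1 − cos θ). Consequently I(0, ∞, cos θ, 1) = 24^{1/4}·s*·(1 − cos θ) and it is attained by n₃. -/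
open MeasureTheory Set Filter
open scoped ENNReal

noncomputable section

lemma dom_zero_top : dom 0 ⊤ = Ici (0 : ℝ) := by
  ext x
  simp [dom]

/-- The Bogomolny-type pointwise lower bound for the energy density. -/
lemma ofReal_mul_enorm_le_density {s b : ℝ} (hs : 0 < s) (hb : 0 ≤ b) (hb2 : b ^ 2 = 4 * √(3 / 2))
    {x y : ℝ} (hx : x ∈ Icc (-1 : ℝ) 1) :
    ENNReal.ofReal (b * s) * ‖y‖ₑ ≤
      ENNReal.ofReal (s ^ 2 * y ^ 2) / ENNReal.ofReal (1 - x ^ 2) +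
        ENNReal.ofReal (√(3 / 2) * (1 - x ^ 2)) := by
  have hw : 0 ≤ 1 - x ^ 2 := by nlinarith [hx.1, hx.2]
  rcases hw.eq_or_lt with hw | hw
  · rcases eq_or_ne y 0 with rfl | hy
    · simp
    · have hpos : 0 < s ^ 2 * y ^ 2 := by positivity
      rw [← hw, ENNReal.ofReal_zero, ENNReal.div_zero (by simpa using hpos)]
      simp
  · rw [Real.enorm_eq_ofReal_abs, ← ENNReal.ofReal_mul (by positivity),
      ← ENNReal.ofReal_div_of_pos hw, ← ENNReal.ofReal_add (by positivity) (by positivity)]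
    refine ENNReal.ofReal_le_ofReal ?_
    have hsq : s ^ 2 * y ^ 2 / (1 - x ^ 2) + √(3 / 2) * (1 - x ^ 2) - b * s * |y| =
        (s * |y| - b / 2 * (1 - x ^ 2)) ^ 2 / (1 - x ^ 2) := by
      rw [show √(3 / 2) = b ^ 2 / 4 by linarith, ← sq_abs y]
      field_simp
      ring
    have : 0 ≤ (s * |y| - b / 2 * (1 - x ^ 2)) ^ 2 / (1 - x ^ 2) := by positivity
    linarith

/-- Every profile on `[0, ∞)` has energy at least `b s (l - a)`, where `b ^ 2 = 4 √(3/2)`. -/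
lemma ofReal_le_ener_of_adm {s b a l : ℝ} (hs : 0 < s) (hb : 0 ≤ b) (hb2 : b ^ 2 = 4 * √(3 / 2))
    {m d : ℝ → ℝ} (h : Adm 0 ⊤ a l m d) :
    ENNReal.ofReal (b * s * (l - a)) ≤ ener s m d 0 ⊤ := by
  obtain ⟨hI, h0, hlim, hftc⟩ := h
  simp only [ENNReal.zero_ne_top, if_false, ENNReal.toReal_zero] at h0
  simp only [if_true] at hlim
  rw [dom_zero_top] at hI hftc
  have hlim' : Tendsto (fun R => ENNReal.ofReal (b * s * (m R - a))) atTop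
      (nhds (ENNReal.ofReal (b * s * (l - a)))) :=
    ENNReal.tendsto_ofReal ((hlim.sub_const a).const_mul (b * s))
  refine le_of_tendsto hlim' ?_
  filter_upwards [eventually_ge_atTop 0] with R hR
  have hsub : Ioc 0 R ⊆ Ici (0 : ℝ) := fun t ht => ht.1.le
  calc ENNReal.ofReal (b * s * (m R - a))
      = ENNReal.ofReal (b * s) * ENNReal.ofReal (∫ t in Ioc 0 R, d t) := by
        rw [ENNReal.ofReal_mul (by positivity), ← h0, (hftc 0 self_mem_Ici R hR).2,
          intervalIntegral.integral_of_le hR]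
    _ ≤ ENNReal.ofReal (b * s) * ∫⁻ t in Ioc 0 R, ‖d t‖ₑ := by
        gcongr
        exact (Real.ofReal_le_enorm _).trans (enorm_integral_le_lintegral_enorm _)
    _ = ∫⁻ t in Ioc 0 R, ENNReal.ofReal (b * s) * ‖d t‖ₑ :=
        (lintegral_const_mul' _ _ ENNReal.ofReal_ne_top).symm
    _ ≤ ∫⁻ t in Ioc 0 R, (ENNReal.ofReal (s ^ 2 * d t ^ 2) / ENNReal.ofReal (1 - m t ^ 2) +
          ENNReal.ofReal (√(3 / 2) * (1 - m t ^ 2))) :=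
        setLIntegral_mono' measurableSet_Ioc fun t ht =>
          ofReal_mul_enorm_le_density hs hb hb2 (hI t (hsub ht))
    _ ≤ ener s m d 0 ⊤ := by
        rw [ener, dom_zero_top]
        exact lintegral_mono_set hsub

/-- A solution of `n' = (b / (2 s)) (1 - n²)` with values in `(-1, 1)` saturates the lower
bound. -/
lemma ener_eq_of_hasDerivAt {s b l : ℝ} (hs : 0 < s) (hb : 0 < b) (hb2 : b ^ 2 = 4 * √(3 / 2))
    {n : ℝ → ℝ} (hlt : ∀ t, 0 < 1 - n t ^ 2)
    (hderiv : ∀ t, HasDerivAt n (b / (2 * s) * (1 - n t ^ 2)) t)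
    (hlim : Tendsto n atTop (nhds l)) :
    ener s n (deriv n) 0 ⊤ = ENNReal.ofReal (b * s * (l - n 0)) := by
  have hd : deriv n = fun t => b / (2 * s) * (1 - n t ^ 2) := funext fun t => (hderiv t).deriv
  have hnn : ∀ t, 0 ≤ deriv n t := fun t => by
    have := hlt t
    rw [hd]
    positivity
  have hder : ∀ t ∈ Ici (0 : ℝ), HasDerivAt n (deriv n t) t := fun t _ => by
    rw [(hderiv t).deriv]
    exact hderiv t
  have hint := integrableOn_Ioi_deriv_of_nonneg' hder (fun t _ => hnn t) hlim
  have hval := integral_Ioi_of_hasDerivAt_of_nonneg' hder (fun t _ => hnn t) hlim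
  have hdens : ∀ t, ENNReal.ofReal (s ^ 2 * deriv n t ^ 2) / ENNReal.ofReal (1 - n t ^ 2) +
      ENNReal.ofReal (√(3 / 2) * (1 - n t ^ 2)) = ENNReal.ofReal (b * s * deriv n t) := fun t => by
    have hw := hlt t
    rw [← ENNReal.ofReal_div_of_pos hw, ← ENNReal.ofReal_add (by positivity) (by positivity), hd,
      show √(3 / 2) = b ^ 2 / 4 by linarith]
    congr 1
    field_simp
    ring
  rw [ener, dom_zero_top, setLIntegral_congr Ioi_ae_eq_Ici.symm]
  simp_rw [hdens]
  rw [← ofReal_integral_eq_lintegral_ofReal (hint.const_mul (b * s))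
    (ae_of_all _ fun t => mul_nonneg (by positivity) (hnn t)), integral_const_mul, hval]

/-- The explicit optimal profile for `I(0, ∞, cos θ, 1)`:
`n₃(r) = (A - e^{-⁴√24 r/s*})/(A + e^{-⁴√24 r/s*})` with `A = (1 + cos θ)/(1 - cos θ)` satisfies
`n₃(0) = cos θ`, `n₃(r) → 1` as `r → ∞`, is admissible, has energy `⁴√24 s* (1 - cos θ)`, every
admissible profile has at least this energy, and hence
`I(0, ∞, cos θ, 1) = ⁴√24 s* (1 - cos θ)` is attained by `n₃`. -/
theorem statement14 (sStar : ℝ) (hs : 0 < sStar) (θ : ℝ) (hθ : θ ∈ Ioo 0 Real.pi) :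
    letI A : ℝ := (1 + Real.cos θ) / (1 - Real.cos θ)
    letI n₃ : ℝ → ℝ := fun r =>
      (A - Real.exp (-((24 : ℝ) ^ ((1 : ℝ) / 4)) * r / sStar)) /
        (A + Real.exp (-((24 : ℝ) ^ ((1 : ℝ) / 4)) * r / sStar))
    n₃ 0 = Real.cos θ ∧
    Tendsto n₃ atTop (nhds 1) ∧
    Adm 0 ⊤ (Real.cos θ) 1 n₃ (deriv n₃) ∧
    ener sStar n₃ (deriv n₃) 0 ⊤ =
      ENNReal.ofReal ((24 : ℝ) ^ ((1 : ℝ) / 4) * sStar * (1 - Real.cos θ)) ∧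
    (∀ m d : ℝ → ℝ, Adm 0 ⊤ (Real.cos θ) 1 m d →
      ENNReal.ofReal ((24 : ℝ) ^ ((1 : ℝ) / 4) * sStar * (1 - Real.cos θ)) ≤
        ener sStar m d 0 ⊤) ∧
    Ival sStar 0 ⊤ (Real.cos θ) 1 =
      ENNReal.ofReal ((24 : ℝ) ^ ((1 : ℝ) / 4) * sStar * (1 - Real.cos θ)) := by
  set b : ℝ := (24 : ℝ) ^ ((1 : ℝ) / 4) with hbdef
  have hb : 0 < b := by positivity
  have hb2 : b ^ 2 = 4 * √(3 / 2) := by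
    have hb4 : (b ^ 2) ^ 2 = 24 := by
      rw [← pow_mul, hbdef, ← Real.rpow_natCast, ← Real.rpow_mul (by norm_num)]
      norm_num
    have hsq : (4 * √(3 / 2)) ^ 2 = 24 := by
      rw [mul_pow, Real.sq_sqrt (by norm_num)]
      norm_num
    exact (pow_left_inj₀ (by positivity) (by positivity) two_ne_zero).1 (hb4.trans hsq.symm)
  have hsin : 0 < Real.sin θ := Real.sin_pos_of_mem_Ioo hθ
  have hcos := Real.sin_sq_add_cos_sq θ
  have hc1 : 0 < 1 - Real.cos θ := by nlinarith
  have hc2 : 0 < 1 + Real.cos θ := by nlinarith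
  set A : ℝ := (1 + Real.cos θ) / (1 - Real.cos θ) with hAdef
  set n₃ : ℝ → ℝ := fun r =>
    (A - Real.exp (-b * r / sStar)) / (A + Real.exp (-b * r / sStar)) with hn₃
  have hA : 0 < A := div_pos hc2 hc1
  have hzero : n₃ 0 = Real.cos θ := by
    simp only [hn₃, hAdef, mul_zero, zero_div, Real.exp_zero]
    field_simp
    ring
  have hexp : Tendsto (fun r : ℝ => Real.exp (-b * r / sStar)) atTop (nhds 0) := by
    refine Real.tendsto_exp_atBot.comp ?_
    have : Tendsto (fun r : ℝ => -(b / sStar) * r) atTop atBot :=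
      tendsto_id.const_mul_atTop_of_neg (neg_neg_of_pos (by positivity))
    exact this.congr fun r => by ring
  have hlim : Tendsto n₃ atTop (nhds 1) := by
    have := (hexp.const_sub A).div (hexp.const_add A) (by simpa using hA.ne')
    rwa [sub_zero, add_zero, div_self hA.ne'] at this
  have hw : ∀ t, 1 - n₃ t ^ 2 =
      4 * A * Real.exp (-b * t / sStar) / (A + Real.exp (-b * t / sStar)) ^ 2 := fun t => by
    have : 0 < A + Real.exp (-b * t / sStar) := by positivity
    simp only [hn₃]
    field_simp
    ring
  have hlt : ∀ t, 0 < 1 - n₃ t ^ 2 := fun t => by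
    rw [hw]
    positivity
  have hderiv : ∀ t, HasDerivAt n₃ (b / (2 * sStar) * (1 - n₃ t ^ 2)) t := fun t => by
    have hpos : 0 < A + Real.exp (-b * t / sStar) := by positivity
    have he : HasDerivAt (fun r : ℝ => Real.exp (-b * r / sStar))
        (Real.exp (-b * t / sStar) * (-b * 1 / sStar)) t :=
      (((hasDerivAt_id t).const_mul (-b)).div_const sStar).exp
    refine ((he.const_sub A).div (he.const_add A) hpos.ne').congr_deriv ?_
    rw [hw]
    field_simp
    ring
  have hd : deriv n₃ = fun t => b / (2 * sStar) * (1 - n₃ t ^ 2) :=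
    funext fun t => (hderiv t).deriv
  have hcont : Continuous n₃ := continuous_iff_continuousAt.2 fun t => (hderiv t).continuousAt
  have hadm : Adm 0 ⊤ (Real.cos θ) 1 n₃ (deriv n₃) := by
    refine ⟨fun t _ => ?_, by simpa using hzero, by simpa using hlim, fun x _ y _ => ?_⟩
    · exact abs_le.1 ((sq_le_one_iff_abs_le_one _).1 (sub_nonneg.1 (hlt t).le))
    · have hii : IntervalIntegrable (deriv n₃) volume x y := by
        rw [hd]
        exact (by fun_prop : Continuous fun t => b / (2 * sStar) * (1 - n₃ t ^ 2)).intervalIntegrable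
          x y
      exact ⟨hii, (intervalIntegral.integral_deriv_eq_sub
        (fun t _ => (hderiv t).differentiableAt) hii).symm⟩
  have hener : ener sStar n₃ (deriv n₃) 0 ⊤ =
      ENNReal.ofReal (b * sStar * (1 - Real.cos θ)) := by
    rw [ener_eq_of_hasDerivAt hs hb hb2 hlt hderiv hlim, hzero]
  have hlower : ∀ m d : ℝ → ℝ, Adm 0 ⊤ (Real.cos θ) 1 m d →
      ENNReal.ofReal (b * sStar * (1 - Real.cos θ)) ≤ ener sStar m d 0 ⊤ :=
    fun m d h => ofReal_le_ener_of_adm hs hb.le hb2 h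
  refine ⟨hzero, hlim, hadm, hener, hlower, le_antisymm ?_ ?_⟩
  · rw [← hener]
    exact iInf_le_of_le n₃ (iInf_le_of_le (deriv n₃) (iInf_le _ hadm))
  · exact le_iInf fun m => le_iInf fun d => le_iInf (hlower m d)

end
end

section
/- Let α ∈ (0, 1), ε ∈ (0, 1), x₀ ∈ ℝ², and let e : ℝ² → [0, ∞] be a measurable function with E := ∫_{B(x₀, ε^{α/2})} e dx < ∞. Then there exists a radius r ∈ (ε^α, ε^{α/2}) such that the boundary integral satisfies ∫_{∂B(x₀, r)} e dH¹ ≤ 4E/(α·r·|ln ε|), where H¹ denotes the 1-dimensional Hausdorff measure on the circle ∂B(x₀, r). -/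
open MeasureTheory Set
open scoped ENNReal NNReal

/-- If `f : ℝ → Y` is `K`-Lipschitz and maps `s` onto a superset of `t`, then the integral over `t`
against the one-dimensional Hausdorff measure is at most `K` times the integral over the parameter
set `s`. -/
theorem LipschitzWith.setLIntegral_hausdorffMeasure_one_le {Y : Type*} [EMetricSpace Y]
    [MeasurableSpace Y] [BorelSpace Y] {K : ℝ≥0} {f : ℝ → Y} (hf : LipschitzWith K f)
    {s : Set ℝ} {t : Set Y} (hst : t ⊆ f '' s)
    {e : Y → ℝ≥0∞} (he : Measurable e) :
    ∫⁻ y in t, e y ∂μH[1] ≤ K * ∫⁻ θ in s, e (f θ) := by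
  have hfm : Measurable f := hf.continuous.measurable
  have key : (μH[1] : Measure Y).restrict t ≤ (K : ℝ≥0∞) • (volume.restrict s).map f := by
    refine Measure.le_iff.2 fun A hA => ?_
    rw [Measure.restrict_apply hA, Measure.smul_apply, Measure.map_apply hfm hA,
      Measure.restrict_apply (hfm hA), smul_eq_mul]
    calc μH[1] (A ∩ t) ≤ μH[1] (f '' (f ⁻¹' A ∩ s)) := by
          refine measure_mono ?_
          rintro y ⟨hyA, hyt⟩
          obtain ⟨θ, hθ, rfl⟩ := hst hyt
          exact ⟨θ, ⟨hyA, hθ⟩, rfl⟩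
      _ ≤ (K : ℝ≥0∞) ^ (1 : ℝ) * μH[1] (f ⁻¹' A ∩ s) := hf.hausdorffMeasure_image_le zero_le_one _
      _ = K * volume (f ⁻¹' A ∩ s) := by rw [ENNReal.rpow_one, hausdorffMeasure_real]
  calc ∫⁻ y in t, e y ∂μH[1] ≤ ∫⁻ y, e y ∂((K : ℝ≥0∞) • (volume.restrict s).map f) :=
        lintegral_mono' key le_rfl
    _ = K * ∫⁻ θ in s, e (f θ) := by
        rw [lintegral_smul_measure, lintegral_map he hfm, smul_eq_mul]

/-- In an isometric copy of the complex plane, the integral over a circle of radius `r` against the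
one-dimensional Hausdorff measure is at most `r` times the integral in the angular variable. -/
theorem setLIntegral_sphere_hausdorffMeasure_le {Y : Type*} [MetricSpace Y]
    [MeasurableSpace Y] [BorelSpace Y] (φ : ℂ ≃ᵢ Y) {e : Y → ℝ≥0∞} (he : Measurable e)
    {r : ℝ} (hr : 0 ≤ r) :
    ∫⁻ y in Metric.sphere (φ 0) r, e y ∂μH[1] ≤
      ENNReal.ofReal r * ∫⁻ θ in Ioo (-Real.pi) Real.pi, e (φ (circleMap 0 r θ)) := by
  have hlip : LipschitzWith (Real.nnabs r) (fun θ => φ (circleMap 0 r θ)) := by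
    simpa [Function.comp_def] using φ.isometry.lipschitz.comp (lipschitzWith_circleMap 0 r)
  have himage : circleMap 0 r '' Ioc (-Real.pi) Real.pi = Metric.sphere 0 r := by
    have := (periodic_circleMap 0 r).image_Ioc Real.two_pi_pos (-Real.pi)
    rwa [range_circleMap, abs_of_nonneg hr, show -Real.pi + 2 * Real.pi = Real.pi by ring] at this
  have hsub : Metric.sphere (φ 0) r ⊆ (fun θ => φ (circleMap 0 r θ)) '' Ioc (-Real.pi) Real.pi := by
    rw [← image_image φ, himage, IsometryEquiv.image_sphere]
  have := hlip.setLIntegral_hausdorffMeasure_one_le hsub he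
  rwa [Measure.restrict_congr_set Ioo_ae_eq_Ioc, ENNReal.ofReal, ← Real.nnabs_of_nonneg hr]

theorem measurable_mul_lintegral_circleMap {g : ℂ → ℝ≥0∞} (hg : Measurable g) :
    Measurable fun r : ℝ =>
      ENNReal.ofReal r * ∫⁻ θ in Ioo (-Real.pi) Real.pi, g (circleMap 0 r θ) := by
  refine ENNReal.measurable_ofReal.mul (Measurable.lintegral_prod_right ?_)
  refine hg.comp (Continuous.measurable ?_)
  simp only [circleMap]
  fun_prop

/-- Integration over a disk of the complex plane in polar coordinates. -/
theorem setLIntegral_ball_eq_lintegral_circleMap {g : ℂ → ℝ≥0∞} (hg : Measurable g) (R : ℝ) :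
    ∫⁻ z in Metric.ball 0 R, g z =
      ∫⁻ r in Ioo 0 R,
        ENNReal.ofReal r * ∫⁻ θ in Ioo (-Real.pi) Real.pi, g (circleMap 0 r θ) := by
  have hind : Measurable ((Metric.ball (0 : ℂ) R).indicator g) :=
    hg.indicator Metric.isOpen_ball.measurableSet
  have hcm : Measurable fun p : ℝ × ℝ => circleMap 0 p.1 p.2 := by
    refine Continuous.measurable ?_
    simp only [circleMap]
    fun_prop
  have hpolar (p : ℝ × ℝ) : Complex.polarCoord.symm p = circleMap 0 p.1 p.2 := by
    simp [circleMap, Complex.exp_mul_I]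
  rw [← lintegral_indicator Metric.isOpen_ball.measurableSet,
    ← Complex.lintegral_comp_polarCoord_symm, polarCoord_target, Measure.volume_eq_prod,
    ← Measure.prod_restrict]
  simp only [hpolar, smul_eq_mul]
  rw [lintegral_prod _ (by fun_prop), ← Ioi_inter_Iio (a := 0) (b := R), inter_comm (Ioi 0),
    ← Measure.restrict_restrict measurableSet_Iio, ← lintegral_indicator measurableSet_Iio]
  refine setLIntegral_congr_fun measurableSet_Ioi fun r (hr : 0 < r) => ?_
  have hmem (θ : ℝ) : circleMap 0 r θ ∈ Metric.ball (0 : ℂ) R ↔ r < R := by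
    simp [abs_of_pos hr]
  by_cases hrR : r < R
  · simp only [indicator_of_mem ((hmem _).2 hrR), indicator_of_mem (mem_Iio.2 hrR)]
    exact lintegral_const_mul' _ _ ENNReal.ofReal_ne_top
  · simp [indicator_of_notMem (mt (hmem _).1 hrR), indicator_of_notMem (mt mem_Iio.1 hrR)]

theorem setLIntegral_Ioo_ofReal_inv {a b : ℝ} (ha : 0 < a) (hab : a ≤ b) :
    ∫⁻ r in Ioo a b, ENNReal.ofReal r⁻¹ = ENNReal.ofReal (Real.log (b / a)) := by
  have hint : IntervalIntegrable (fun r : ℝ => r⁻¹) volume a b :=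
    intervalIntegral.intervalIntegrable_inv
      (fun x hx => (ha.trans_le (uIcc_of_le hab ▸ hx).1).ne') continuousOn_id
  rw [← integral_inv_of_pos ha (ha.trans_le hab), intervalIntegral.integral_of_le hab,
    ofReal_integral_eq_lintegral_ofReal ((intervalIntegrable_iff_integrableOn_Ioc_of_le hab).1 hint),
    Measure.restrict_congr_set Ioo_ae_eq_Ioc]
  filter_upwards [ae_restrict_mem measurableSet_Ioc] with r hr
  exact inv_nonneg.2 (ha.trans hr.1).le

/-- Averaging over circles: if `e ≥ 0` is measurable on the plane with finite integral `E` over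
the disk `B(x₀, ε^{α/2})`, then some circle `∂B(x₀, r)` with `r ∈ (ε^α, ε^{α/2})` carries
boundary integral (w.r.t. the 1-dimensional Hausdorff measure) at most `4E/(α r |ln ε|)`. -/
theorem statement15 (α ε : ℝ) (hα : α ∈ Ioo (0 : ℝ) 1) (hε : ε ∈ Ioo (0 : ℝ) 1)
    (x₀ : EuclideanSpace ℝ (Fin 2)) (e : EuclideanSpace ℝ (Fin 2) → ℝ≥0∞)
    (hme : Measurable e)
    (hE : ∫⁻ x in Metric.ball x₀ (ε ^ (α / 2)), e x < ⊤) :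
    ∃ r ∈ Ioo (ε ^ α) (ε ^ (α / 2)),
      ∫⁻ x in Metric.sphere x₀ r, e x ∂μH[1] ≤
        ENNReal.ofReal (4 / (α * r * |Real.log ε|)) *
          ∫⁻ x in Metric.ball x₀ (ε ^ (α / 2)), e x := by
  obtain ⟨hα0, -⟩ := hα
  obtain ⟨hε0, hε1⟩ := hε
  let φ : ℂ ≃ᵢ EuclideanSpace ℝ (Fin 2) :=
    Complex.orthonormalBasisOneI.repr.toIsometryEquiv.trans (IsometryEquiv.addLeft x₀)
  have hφ0 : φ 0 = x₀ := by simp [φ]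
  have hφ : MeasurePreserving φ volume volume :=
    (measurePreserving_add_left volume x₀).comp Complex.orthonormalBasisOneI.measurePreserving_repr
  have heφ : Measurable (e ∘ φ) := hme.comp hφ.measurable
  set a := ε ^ α with ha
  set b := ε ^ (α / 2) with hb
  set E := ∫⁻ x in Metric.ball x₀ b, e x with hEdef
  have ha0 : 0 < a := Real.rpow_pos_of_pos hε0 _
  have hab : a < b := Real.rpow_lt_rpow_of_exponent_gt hε0 hε1 (by linarith)
  have hlog : Real.log ε < 0 := Real.log_neg hε0 hε1
  have hlogab : Real.log (b / a) = α / 2 * |Real.log ε| := by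
    rw [Real.log_div (ha0.trans hab).ne' ha0.ne', ha, hb, Real.log_rpow hε0, Real.log_rpow hε0,
      abs_of_neg hlog]
    ring
  let T : ℝ → ℝ≥0∞ := fun r =>
    ENNReal.ofReal r * ∫⁻ θ in Ioo (-Real.pi) Real.pi, (e ∘ φ) (circleMap 0 r θ)
  have hTE : ∫⁻ r in Ioo a b, T r ≤ E := by
    calc ∫⁻ r in Ioo a b, T r ≤ ∫⁻ r in Ioo 0 b, T r :=
          lintegral_mono_set (Ioo_subset_Ioo_left ha0.le)
      _ = ∫⁻ z in Metric.ball 0 b, (e ∘ φ) z :=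
          (setLIntegral_ball_eq_lintegral_circleMap heφ b).symm
      _ = E := by
          rw [hEdef, ← hφ.setLIntegral_comp_preimage Metric.isOpen_ball.measurableSet hme, ← hφ0,
            φ.isometry.preimage_ball]
          rfl
  have hC : ∫⁻ r in Ioo a b, ENNReal.ofReal (4 / (α * r * |Real.log ε|)) * E = 2 * E := by
    have hL : 0 < |Real.log ε| := abs_pos.2 hlog.ne
    have hsplit (r : ℝ) : ENNReal.ofReal (4 / (α * r * |Real.log ε|)) =
        ENNReal.ofReal (4 / (α * |Real.log ε|)) * ENNReal.ofReal r⁻¹ := by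
      rw [← ENNReal.ofReal_mul (by positivity)]
      congr 1
      simp only [div_eq_mul_inv, mul_inv]
      ring
    rw [lintegral_mul_const' _ _ hE.ne]
    simp_rw [hsplit]
    rw [lintegral_const_mul' _ _ ENNReal.ofReal_ne_top, setLIntegral_Ioo_ofReal_inv ha0 hab.le,
      hlogab, ← ENNReal.ofReal_mul (by positivity),
      show 4 / (α * |Real.log ε|) * (α / 2 * |Real.log ε|) = 2 by field_simp; norm_num]
    norm_num
  by_contra! h
  have hlt : ∫⁻ r in Ioo a b, ENNReal.ofReal (4 / (α * r * |Real.log ε|)) * E <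
      ∫⁻ r in Ioo a b, T r := by
    refine setLIntegral_strict_mono measurableSet_Ioo (by simp [hab])
      (measurable_mul_lintegral_circleMap heφ)
      (hC ▸ ENNReal.mul_ne_top (by norm_num) hE.ne) (ae_of_all _ fun r hr => ?_)
    refine (h r hr).trans_le ?_
    rw [← hφ0]
    exact setLIntegral_sphere_hausdorffMeasure_le φ hme (ha0.trans hr.1).le
  rw [hC, two_mul] at hlt
  exact (hlt.trans_le hTE).not_ge le_self_add
end

section
/- Let α ∈ (0, 1). There exist constants C_Ω > 0 and ε₁ > 0 such that for every 0 < ε ≤ ε₁, every radius r ∈ (ε^α, ε^{α/2}) and every y ∈ Ω', there exists a point z ∈ B(y, r) ∩ Ω' such that ν(x)·(x − z) ≥ C_Ω·r for every x ∈ ∂Ω' ∩ B(y, r) at which the outward unit normal ν of Ω' is defined, namely ν(x) = (−1, 0) if x = (0, x₂) with |x₂| > 1, and ν(x) = −x if |x| = 1 with first coordinate x₁ > 0. -/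
open Metric Set
open scoped RealInnerProductSpace

noncomputable section

/-- The planar cross-section `Ω' = {(ρ, z) : ρ > 0, ρ² + z² > 1}` of the exterior of the unit
ball, with `ρ = x 0` and `z = x 1`. -/
def OmegaP : Set (EuclideanSpace ℝ (Fin 2)) := {x | 0 < x 0 ∧ 1 < ‖x‖}

/-- Moving from `y` by `r / 4` along `e + y / ‖y‖` gives a point of `ball y r`. -/
lemma dist_add_smul_add_normalize_lt {E : Type*} [NormedAddCommGroup E] [NormedSpace ℝ E]
    {e y : E} (he : ‖e‖ = 1) (hy : 0 < ‖y‖) {r : ℝ} (hr : 0 < r) :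
    dist (y + (r / 4) • (e + ‖y‖⁻¹ • y)) y < r := by
  have h : ‖e + ‖y‖⁻¹ • y‖ ≤ 2 := by
    have hn : ‖‖y‖⁻¹ • y‖ = 1 := by
      rw [norm_smul, norm_inv, norm_norm, inv_mul_cancel₀ hy.ne']
    linarith [norm_add_le e (‖y‖⁻¹ • y)]
  rw [dist_eq_norm, add_sub_cancel_left, norm_smul, Real.norm_of_nonneg (by positivity)]
  nlinarith

/-- On the unit sphere, `⟪x, y⟫` is almost `1` when `x` is close to a point `y` outside the unit
ball. -/
lemma one_sub_sq_div_two_le_inner {E : Type*} [NormedAddCommGroup E] [InnerProductSpace ℝ E]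
    {x y : E} {r : ℝ} (hx : ‖x‖ = 1) (hy : 1 ≤ ‖y‖) (hxy : ‖x - y‖ ≤ r) :
    1 - r ^ 2 / 2 ≤ ⟪x, y⟫ := by
  have h := norm_sub_sq_real x y
  rw [hx] at h
  have : ‖x - y‖ ^ 2 ≤ r ^ 2 := by gcongr
  nlinarith

/-- Moving from `y` by `r / 4` along `e + y / ‖y‖` stays at distance at least `r / 16` from the
tangent lines of the unit sphere at its points `x` close to `y` with `0 ≤ ⟪x, e⟫`. -/
lemma one_add_div_le_inner_add_smul {E : Type*} [NormedAddCommGroup E] [InnerProductSpace ℝ E]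
    {e x y : E} {r : ℝ} (hr : r ≤ 1 / 8) (hx : ‖x‖ = 1) (hxe : 0 ≤ ⟪x, e⟫)
    (hy : 1 ≤ ‖y‖) (hxy : ‖x - y‖ ≤ r) :
    1 + 1 / 16 * r ≤ ⟪x, y + (r / 4) • (e + ‖y‖⁻¹ • y)⟫ := by
  have hr0 : 0 ≤ r := (norm_nonneg _).trans hxy
  have h1 := one_sub_sq_div_two_le_inner hx hy hxy
  have hn : ‖y‖ ≤ 1 + r := by linarith [norm_sub_norm_le y x, norm_sub_rev x y]
  have h2 : 1 / 2 ≤ ‖y‖⁻¹ * ⟪x, y⟫ := by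
    rw [inv_mul_eq_div, le_div_iff₀ (by linarith)]
    nlinarith
  simp only [inner_add_right, inner_smul_right]
  nlinarith

/-- For every `α ∈ (0,1)` there are `C_Ω > 0` and `ε₁ > 0` such that for all `0 < ε ≤ ε₁`,
`r ∈ (ε^α, ε^{α/2})` and `y ∈ Ω'`, some `z ∈ B(y,r) ∩ Ω'` satisfies `ν(x)·(x - z) ≥ C_Ω r` at
every boundary point `x ∈ ∂Ω' ∩ B(y,r)` where the outward normal `ν` is defined: `ν(x) = (-1,0)`
on the axis rays `x = (0, x₂)`, `|x₂| > 1`, and `ν(x) = -x` on the half unit circle `‖x‖ = 1`,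
`x₁ > 0`. -/
theorem statement17 (α : ℝ) (hα : α ∈ Ioo (0 : ℝ) 1) :
    ∃ CΩ > (0 : ℝ), ∃ ε₁ > (0 : ℝ), ∀ ε : ℝ, 0 < ε → ε ≤ ε₁ →
      ∀ r ∈ Ioo (ε ^ α) (ε ^ (α / 2)), ∀ y ∈ OmegaP,
        ∃ z ∈ ball y r ∩ OmegaP,
          (∀ x : EuclideanSpace ℝ (Fin 2), x ∈ ball y r → x 0 = 0 → 1 < |x 1| →
            CΩ * r ≤ ⟪EuclideanSpace.single (0 : Fin 2) (-1 : ℝ), x - z⟫) ∧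
          (∀ x : EuclideanSpace ℝ (Fin 2), x ∈ ball y r → ‖x‖ = 1 → 0 < x 0 →
            CΩ * r ≤ ⟪-x, x - z⟫) := by
  obtain ⟨hα0, -⟩ := hα
  refine ⟨1 / 16, by norm_num, (1 / 8) ^ (2 / α), by positivity, ?_⟩
  rintro ε hε hε₁ r ⟨hr1, hr2⟩ y ⟨hy0, hy1⟩
  have hr0 : 0 < r := (Real.rpow_pos_of_pos hε α).trans hr1
  have hr : r ≤ 1 / 8 := by
    refine hr2.le.trans ((Real.rpow_le_rpow hε.le hε₁ (by positivity)).trans_eq ?_)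
    rw [← Real.rpow_mul (by norm_num), div_mul_div_cancel₀ hα0.ne', div_self two_ne_zero,
      Real.rpow_one]
  have hyp : 0 < ‖y‖ := by linarith
  set e : EuclideanSpace ℝ (Fin 2) := EuclideanSpace.single 0 1 with he
  have hin (x : EuclideanSpace ℝ (Fin 2)) : ⟪x, e⟫ = x 0 := by simp [he, EuclideanSpace.inner_single_right]
  set z := y + (r / 4) • (e + ‖y‖⁻¹ • y) with hz
  have hz0 : 1 / 16 * r ≤ z 0 := by
    have hz0' : z 0 = y 0 + r / 4 * (1 + ‖y‖⁻¹ * y 0) := by simp [hz, he, mul_add]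
    have : 0 < ‖y‖⁻¹ * y 0 := by positivity
    rw [hz0']
    nlinarith
  have hz1 : 1 < ‖z‖ := by
    have h : ‖y‖ ^ 2 ≤ ⟪y, z⟫ := by
      simp only [hz, inner_add_right, inner_smul_right, hin, real_inner_self_eq_norm_sq]
      exact le_add_of_nonneg_right (by positivity)
    nlinarith [real_inner_le_norm y z]
  refine ⟨z, ⟨?_, by linarith, hz1⟩, ?_, ?_⟩
  · exact dist_add_smul_add_normalize_lt (by simp [he]) hyp hr0
  · intro x _ hx0 _
    simpa [EuclideanSpace.inner_single_left, hx0] using hz0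
  · intro x hx hx1 hx0
    rw [mem_ball, dist_eq_norm] at hx
    have h := one_add_div_le_inner_add_smul (e := e) hr hx1 ((hin x).symm ▸ hx0.le) hy1.le hx.le
    rw [inner_neg_left, inner_sub_right, real_inner_self_eq_norm_sq, hx1]
    linarith

end
end
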